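/- Let λ, μ be partitions with |λ| + |μ| = n, and let ν be a partition with 2n ≥ |ν| + ν₁. If the coefficient of s_{ν[2n]} in the Schur expansion of (s_λ ∘ h₂)(s_μ ∘ e₂) is nonzero, then |λ| − λ₁ ≤ |ν| and |μ| ≤ |ν|. -/

import Mathlib

open MvPolynomial Finset

/-- The ring of symmetric functions (with rational coefficients), realized as the free
commutative `ℚ`-algebra on the complete homogeneous symmetric functions `h₁, h₂, …`,
where the variable `n : ℕ` corresponds to `h_{n+1}`. -/
abbrev SymFn : Type := MvPolynomial ℕ ℚ

/-- The complete homogeneous symmetric function `h_n`, with `h_n = 0` for `n < 0`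
and `h_0 = 1`. -/
noncomputable def hh (n : ℤ) : SymFn :=
  if n < 0 then 0 else if n = 0 then 1 else MvPolynomial.X (n.toNat - 1)

/-- The power sum symmetric functions, defined from the `h`'s by Newton's identities:
`p_k = k h_k - ∑_{i=1}^{k-1} h_i p_{k-i}`. -/
noncomputable def pp : ℕ → SymFn
  | 0 => 0
  | (k+1) => ((k : ℚ) + 1) • hh (k+1) - ∑ i ∈ Finset.range k, hh (i+1) * pp (k - i)
  decreasing_by exact Nat.lt_succ_of_le (Nat.sub_le _ _)

/-- `h_m` written as a polynomial in the power sums (the variable `j` stands for `p_{j+1}`),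
via the recursion `m h_m = ∑_{i=1}^{m} p_i h_{m-i}`. -/
noncomputable def hInP : ℕ → MvPolynomial ℕ ℚ
  | 0 => 1
  | (m+1) => ((m : ℚ) + 1)⁻¹ •
      ∑ i ∈ Finset.range (m+1), MvPolynomial.X i * hInP (m - i)
  decreasing_by exact Nat.lt_succ_of_le (Nat.sub_le _ _)

/-- The `k`-th Adams operation: the algebra endomorphism of `SymFn` determined by
`p_m ↦ p_{k m}` on power sums. -/
noncomputable def adams (k : ℕ) : SymFn →ₐ[ℚ] SymFn :=
  aeval fun m => (aeval fun j => pp (k * (j+1))) (hInP (m+1))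

/-- The plethysm `h_k ∘ g`, via the recursion
`k (h_k ∘ g) = ∑_{i=1}^{k} (p_i ∘ g) (h_{k-i} ∘ g)`, where `p_i ∘ g = adams i g`. -/
noncomputable def hPleth (g : SymFn) : ℕ → SymFn
  | 0 => 1
  | (k+1) => ((k : ℚ) + 1)⁻¹ •
      ∑ i ∈ Finset.range (k+1), adams (i+1) g * hPleth g (k - i)
  decreasing_by exact Nat.lt_succ_of_le (Nat.sub_le _ _)

/-- The (outer) plethysm `f ∘ g` of symmetric functions: the algebra homomorphism
in the left argument sending `h_k ↦ h_k ∘ g`. -/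
noncomputable def pleth (f g : SymFn) : SymFn := aeval (fun m => hPleth g (m+1)) f

/-- The elementary symmetric functions, via `e_k = ∑_{i=1}^{k} (-1)^{i-1} h_i e_{k-i}`. -/
noncomputable def ee : ℕ → SymFn
  | 0 => 1
  | (k+1) => ∑ i ∈ Finset.range (k+1), ((-1 : ℚ))^i • (hh (i+1) * ee (k - i))
  decreasing_by exact Nat.lt_succ_of_le (Nat.sub_le _ _)

/-- The parts of a multiset, as a weakly decreasing list. -/
def sortedParts (m : Multiset ℕ) : List ℕ := (m.sort (· ≤ ·)).reverse

/-- The Schur function `s_m`, via the Jacobi–Trudi determinant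
`s_λ = det (h_{λ_i + j - i})`. -/
noncomputable def schur (m : Multiset ℕ) : SymFn :=
  Matrix.det (Matrix.of fun i j : Fin (Multiset.card m) =>
    hh (((sortedParts m).getD i 0 : ℤ) + (j : ℤ) - (i : ℤ)))

/-- A multiset of naturals is a partition when all its parts are positive. -/
def IsPartition (m : Multiset ℕ) : Prop := 0 ∉ m

/-- A strict partition: positive, pairwise distinct parts. -/
def IsStrictPartition (m : Multiset ℕ) : Prop := 0 ∉ m ∧ m.Nodup

/-- The first (largest) part `λ₁` of a partition. -/
def firstPart (m : Multiset ℕ) : ℕ := m.sup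

/-- The size `|λ|` of a partition. -/
def psize (m : Multiset ℕ) : ℕ := m.sum

/-- The conjugate (transposed) partition. -/
def conj (m : Multiset ℕ) : Multiset ℕ :=
  ((List.range m.sup).map fun i => Multiset.card (m.filter fun x => i < x) : List ℕ)

/-- The partition `ν[N] = (N - |ν|, ν₁, ν₂, …)` (valid when `N ≥ |ν| + ν₁`). -/
def padded (ν : Multiset ℕ) (N : ℕ) : Multiset ℕ := (N - ν.sum) ::ₘ ν

/-- `c` is the expansion of `f` in the basis of Schur functions indexed by partitions. -/
def SchurExpansion (f : SymFn) (c : Multiset ℕ →₀ ℚ) : Prop :=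
  (∀ κ ∈ c.support, IsPartition κ) ∧ f = c.sum fun κ a => a • schur κ

/-- `Φ` of a Schur expansion: the largest first part of a partition occurring in it. -/
def Phi (c : Multiset ℕ →₀ ℚ) : ℕ := c.support.sup firstPart

/-- The partition `2α`, doubling every part. -/
def double (m : Multiset ℕ) : Multiset ℕ := m.map (2 * ·)

/-- For a strict partition `β = (β₁ > β₂ > … > β_r > 0)`, the partition `Γ(β)` with
Frobenius coordinates `(β₁ - 1, …, β_r - 1 | β₁, …, β_r)`. -/
def gammaFrob (β : Multiset ℕ) : Multiset ℕ :=
  let b := sortedParts β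
  let r := b.length
  (((List.range r).map fun i => b.getD i 0 + i)
    ++ ((List.range (b.getD 0 0 + 1 - r)).map fun t =>
        ((List.range r).filter fun j => r + t ≤ b.getD j 0 + j).length) : List ℕ)

/-- `p` has degree at most the integer `k`. -/
def degLE (p : Polynomial SymFn) (k : ℤ) : Prop := ∀ m : ℕ, k < m → p.coeff m = 0

theorem degLE.mono {p : Polynomial SymFn} {k l : ℤ} (h : degLE p k) (hkl : k ≤ l) : degLE p l :=
  fun m hm => h m (lt_of_le_of_lt hkl hm)

theorem degLE.add {p q : Polynomial SymFn} {k : ℤ} (hp : degLE p k) (hq : degLE q k) :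
    degLE (p + q) k := fun m hm => by
  rw [Polynomial.coeff_add, hp m hm, hq m hm, add_zero]

theorem degLE_zero (k : ℤ) : degLE 0 k := fun m _ => by simp

theorem degLE.sum {ι : Type*} {s : Finset ι} {f : ι → Polynomial SymFn} {k : ℤ}
    (h : ∀ i ∈ s, degLE (f i) k) : degLE (∑ i ∈ s, f i) k := fun m hm => by
  rw [Polynomial.finsetSum_coeff]
  exact Finset.sum_eq_zero fun i hi => h i hi m hm

theorem degLE.mul {p q : Polynomial SymFn} {k l : ℤ} (hp : degLE p k) (hq : degLE q l) :
    degLE (p * q) (k + l) := fun m hm => by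
  rw [Polynomial.coeff_mul]
  refine Finset.sum_eq_zero fun x hx => ?_
  have hx' := Finset.HasAntidiagonal.mem_antidiagonal.1 hx
  by_cases h : k < (x.1 : ℤ)
  · rw [hp _ h, zero_mul]
  · rw [hq x.2 (by omega), mul_zero]

theorem degLE_C (a : SymFn) : degLE (Polynomial.C a) 0 := fun m hm => by
  rw [Polynomial.coeff_C, if_neg (by omega)]

theorem degLE_one : degLE 1 0 := by
  rw [← Polynomial.C_1]; exact degLE_C 1

theorem degLE_X_pow (n : ℕ) : degLE (Polynomial.X ^ n) n := fun m hm => by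
  rw [Polynomial.coeff_X_pow, if_neg (by omega)]

theorem degLE.smul {p : Polynomial SymFn} {k : ℤ} (a : ℚ) (hp : degLE p k) :
    degLE (a • p) k := fun m hm => by
  rw [Polynomial.coeff_smul, hp m hm, smul_zero]

theorem degLE.prod {ι : Type*} (s : Finset ι) {f : ι → Polynomial SymFn} {b : ι → ℤ}
    (h : ∀ i ∈ s, degLE (f i) (b i)) : degLE (∏ i ∈ s, f i) (∑ i ∈ s, b i) := by
  classical
  induction s using Finset.induction_on with
  | empty => simpa using degLE_one
  | insert a s ha ih =>
    rw [Finset.prod_insert ha, Finset.sum_insert ha]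
    exact (h a (by simp)).mul (ih fun i hi => h i (by simp [hi]))

theorem degLE_det {n : ℕ} (M : Matrix (Fin n) (Fin n) (Polynomial SymFn)) (a b : Fin n → ℤ)
    (h : ∀ i j, degLE (M i j) (a i + b j)) : degLE M.det (∑ i, a i + ∑ i, b i) := by
  rw [Matrix.det_apply]
  refine degLE.sum fun σ _ => ?_
  have h1 : degLE (∏ i, M (σ i) i) (∑ i, a i + ∑ i, b i) := by
    have := degLE.prod Finset.univ (f := fun i => M (σ i) i) (b := fun i => a (σ i) + b i)
      (fun i _ => h _ _)
    rwa [Finset.sum_add_distrib, Equiv.sum_comp σ a] at this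
  intro m hm
  rw [Polynomial.coeff_smul, h1 m hm, smul_zero]

theorem hh_neg {k : ℤ} (h : k < 0) : hh k = 0 := by simp [hh, h]
theorem hh_zero : hh 0 = 1 := by simp [hh]
theorem hh_succ (m : ℕ) : hh ((m : ℤ) + 1) = MvPolynomial.X m := by
  unfold hh
  rw [if_neg (by omega), if_neg (by omega)]
  congr 1

/-- The substitution `f[X] ↦ f[X + t]`. -/
noncomputable def DD : SymFn →ₐ[ℚ] Polynomial SymFn :=
  aeval fun m => ∑ k ∈ Finset.range (m + 2), Polynomial.C (hh ((m : ℤ) + 1 - k)) * Polynomial.X ^ k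

theorem DD_coeff (k : ℤ) (m : ℕ) : (DD (hh k)).coeff m = hh (k - m) := by
  rcases lt_trichotomy k 0 with h | h | h
  · rw [hh_neg h, map_zero, hh_neg (by omega)]; simp
  · subst h
    rw [hh_zero, map_one, Polynomial.coeff_one]
    split_ifs with h
    · subst h; simp [hh_zero]
    · rw [hh_neg (by omega)]
  · obtain ⟨n, rfl⟩ : ∃ n : ℕ, k = n + 1 := ⟨(k - 1).toNat, by omega⟩
    rw [hh_succ, DD, aeval_X, Polynomial.finsetSum_coeff]
    simp only [Polynomial.coeff_C_mul, Polynomial.coeff_X_pow, mul_ite, mul_one, mul_zero]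
    rw [Finset.sum_ite_eq]
    split_ifs with h
    · rfl
    · rw [hh_neg]
      simp at h
      omega

theorem DD_rec (k : ℤ) :
    DD (hh k) = Polynomial.C (hh k) + Polynomial.X * DD (hh (k - 1)) := by
  ext1 m
  rw [Polynomial.coeff_add, DD_coeff]
  cases m with
  | zero => simp
  | succ m =>
    rw [Polynomial.coeff_X_mul, DD_coeff, Polynomial.coeff_C_succ, zero_add]
    congr 1; push_cast; ring

theorem newton (n : ℕ) :
    ((n : ℚ)) • hh n = ∑ i ∈ Finset.range n, hh i * pp (n - i) := by
  cases n with
  | zero => simp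
  | succ k =>
    rw [Finset.sum_range_succ']
    simp only [Nat.cast_zero, hh_zero, one_mul, Nat.sub_zero, Nat.add_sub_add_right]
    rw [pp]
    push_cast
    ring

theorem newton_shift {R : Type*} [CommRing R] [Algebra ℚ R] (g h : ℤ → R) (p : ℕ → R) (x : R)
    (hg : ∀ k, g k = h k + x * g (k - 1)) (hneg : g (-1) = 0)
    (hN : ∀ n : ℕ, (n : ℚ) • h n = ∑ i ∈ Finset.range n, h i * p (n - i)) (n : ℕ) :
    (n : ℚ) • g n = ∑ i ∈ Finset.range n, g i * (p (n - i) + x ^ (n - i)) := by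
  induction n with
  | zero => simp
  | succ n ih =>
    have e1 : g ((n + 1 : ℕ) : ℤ) = h ((n + 1 : ℕ) : ℤ) + x * g n := by
      rw [hg]; push_cast; rw [add_sub_cancel_right]
    have e3 : ∑ i ∈ Finset.range (n+1), g i * p (n + 1 - i) =
        ∑ i ∈ Finset.range (n+1), h i * p (n + 1 - i) +
          x * ∑ i ∈ Finset.range n, g i * p (n - i) := by
      have e : ∀ i ∈ Finset.range (n+1), g i * p (n + 1 - i) =
         h i * p (n + 1 - i) + x * (g ((i : ℤ) - 1) * p (n + 1 - i)) := by
        intro i _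
        rw [hg]; ring
      have e' : ∑ i ∈ Finset.range (n+1), g ((i : ℤ) - 1) * p (n + 1 - i) =
          ∑ i ∈ Finset.range n, g i * p (n - i) := by
        rw [Finset.sum_range_succ']
        simp [hneg]
      rw [Finset.sum_congr rfl e, Finset.sum_add_distrib, ← Finset.mul_sum, e']
    have e4 : ∑ i ∈ Finset.range (n+1), g i * x ^ (n + 1 - i) =
        x * g n + x * ∑ i ∈ Finset.range n, g i * x ^ (n - i) := by
      rw [Finset.sum_range_succ, Finset.mul_sum, add_comm]
      congr 1
      · simp [mul_comm]
      · refine Finset.sum_congr rfl fun i hi => ?_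
        have := Finset.mem_range.1 hi
        rw [show n + 1 - i = (n - i) + 1 by omega, pow_succ]; ring
    simp only [mul_add, Finset.sum_add_distrib] at ih ⊢
    rw [e3, e4, ← hN, e1, smul_add]
    have e6 : ((n + 1 : ℕ) : ℚ) • (x * g n) = x * ((n : ℚ) • g n) + x * g n := by
      push_cast
      rw [add_smul, one_smul, mul_smul_comm]
    rw [e6, ih]; ring

theorem DD_newton (n : ℕ) :
    ((n : ℚ)) • DD (hh n) = ∑ i ∈ Finset.range n, DD (hh i) *
      (Polynomial.C (pp (n - i)) + Polynomial.X ^ (n - i)) := by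
  refine newton_shift (fun k => DD (hh k)) (fun k => Polynomial.C (hh k))
    (fun k => Polynomial.C (pp k)) Polynomial.X DD_rec ?_ ?_ n
  · change DD (hh (-1)) = 0
    rw [hh_neg (by omega), map_zero]
  · intro n
    rw [Polynomial.smul_C, newton, map_sum]
    simp only [map_mul]

theorem DD_pp (n : ℕ) (hn : n ≠ 0) : DD (pp n) = Polynomial.C (pp n) + Polynomial.X ^ n := by
  induction n using Nat.strong_induction_on with
  | _ n ih =>
    have h1 := congrArg DD (newton n)
    rw [map_smul, DD_newton, map_sum] at h1
    obtain ⟨k, rfl⟩ := Nat.exists_eq_succ_of_ne_zero hn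
    rw [Finset.sum_range_succ', Finset.sum_range_succ'] at h1
    have h2 : ∀ i ∈ Finset.range k, DD (hh ((i + 1 : ℕ) : ℤ)  * pp (k.succ - (i + 1))) =
        DD (hh ((i + 1 : ℕ) : ℤ)) *
          (Polynomial.C (pp (k.succ - (i + 1))) + Polynomial.X ^ (k.succ - (i + 1))) := by
      intro i hi
      have := Finset.mem_range.1 hi
      rw [map_mul, ih _ (by omega) (by omega)]
    rw [Finset.sum_congr rfl h2] at h1
    have h3 := add_left_cancel h1
    simp only [Nat.cast_zero, hh_zero, map_one, one_mul, Nat.sub_zero] at h3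
    exact h3.symm

theorem hh_one' : hh 1 = X 0 := by simpa using hh_succ 0
theorem hh_two' : hh 2 = X 1 := by simpa using hh_succ 1

theorem adams_h1 (k : ℕ) : adams k (hh 1) = pp k := by
  rw [hh_one', adams, aeval_X]
  simp [hInP]

theorem adams_h2 (k : ℕ) : adams k (hh 2) = (2⁻¹ : ℚ) • (pp k ^ 2 + pp (2 * k)) := by
  rw [hh_two', adams, aeval_X]
  simp [hInP, Finset.sum_range_succ]
  norm_num
  rw [mul_comm k 2]; ring_nf

theorem ee_two : ee 2 = hh 1 ^ 2 - hh 2 := by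
  simp [ee, Finset.sum_range_succ, hh_zero]
  norm_num
  ring

theorem DD_adams_h2 (k : ℕ) (hk : k ≠ 0) : DD (adams k (hh 2)) =
    (Polynomial.C (adams k (hh 2)) + Polynomial.C (pp k) * Polynomial.X ^ k)
      + Polynomial.X ^ (2 * k) := by
  rw [adams_h2, map_smul, map_add, map_pow, DD_pp k hk, DD_pp (2 * k) (by omega),
    ← Polynomial.smul_C, map_add, map_pow]
  have : ∀ p : Polynomial SymFn, p = (2⁻¹ : ℚ) • (2 * p) := fun p => by
    rw [← smul_mul_assoc]
    rw [show ((2⁻¹ : ℚ) • (2 : Polynomial SymFn)) = 1 from ?_, one_mul]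
    rw [show (2 : Polynomial SymFn) = (2 : ℚ) • 1 by rw [ofNat_smul_eq_nsmul]; simp, smul_smul]
    norm_num
  rw [this ((2⁻¹ : ℚ) • (Polynomial.C (pp k) ^ 2 + Polynomial.C (pp (2 * k))) +
    Polynomial.C (pp k) * Polynomial.X ^ k + Polynomial.X ^ (2 * k)), mul_add, mul_add,
    mul_smul_comm, ← this (Polynomial.C (pp k) ^ 2 + Polynomial.C (pp (2 * k)))]
  congr 1
  ring

theorem DD_adams_e2 (k : ℕ) (hk : k ≠ 0) : DD (adams k (ee 2)) =
    (Polynomial.C (adams k (ee 2)) + Polynomial.C (pp k) * Polynomial.X ^ k) := by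
  rw [ee_two, map_sub, map_sub, DD_adams_h2 k hk, map_pow, adams_h1, map_pow, DD_pp k hk, map_sub,
    map_pow]
  ring

/-- recursion for `hPleth` -/
theorem hPleth_rec (g : SymFn) (k : ℕ) : (((k + 1 : ℕ)) : ℚ) • hPleth g (k + 1) =
    ∑ i ∈ Finset.range (k+1), adams (i+1) g * hPleth g (k - i) := by
  rw [hPleth, smul_smul, Nat.cast_succ, mul_inv_cancel₀ (by positivity), one_smul]

theorem degLE_of_rec (A : ℕ → Polynomial SymFn) (a : ℕ → Polynomial SymFn)
    (ha : ∀ i, degLE (a i) ((i : ℤ) + 1)) (h0 : degLE (A 0) 0)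
    (hrec : ∀ k : ℕ, ((k + 1 : ℕ) : ℚ) • A (k + 1) = ∑ i ∈ Finset.range (k + 1), a i * A (k - i))
    (n : ℕ) : degLE (A n) n := by
  induction n using Nat.strong_induction_on with
  | _ n ih =>
    cases n with
    | zero => simpa using h0
    | succ k =>
      have : A (k + 1) = ((k + 1 : ℕ) : ℚ)⁻¹ • ∑ i ∈ Finset.range (k + 1), a i * A (k - i) := by
        rw [← hrec, smul_smul, inv_mul_cancel₀ (by positivity), one_smul]
      rw [this]
      refine degLE.smul _ (degLE.sum fun i hi => ?_)
      have := Finset.mem_range.1 hi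
      exact ((ha i).mul (ih (k - i) (by omega))).mono (by omega)

theorem a_bound (x y : SymFn) (i : ℕ) :
    degLE (Polynomial.C x + Polynomial.C y * Polynomial.X ^ (i + 1)) ((i : ℤ) + 1) := by
  refine ((degLE_C x).mono (by omega)).add ?_
  exact ((degLE_C y).mul (degLE_X_pow (i + 1))).mono (by push_cast; omega)

theorem E_bound (n : ℕ) : degLE (DD (hPleth (ee 2) n)) n := by
  refine degLE_of_rec (fun n => DD (hPleth (ee 2) n)) (fun i => DD (adams (i+1) (ee 2)))
    (fun i => ?_) ?_ (fun k => ?_) n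
  · rw [DD_adams_e2 _ (by omega)]; exact a_bound _ _ _
  · simpa [hPleth] using degLE_one
  · rw [← map_smul, hPleth_rec, map_sum]; simp only [map_mul]

/-- `h_k ∘ g` for integer `k`. -/
noncomputable def Hz (g : SymFn) (k : ℤ) : SymFn := if k < 0 then 0 else hPleth g k.toNat

theorem Hz_nat (g : SymFn) (k : ℕ) : Hz g k = hPleth g k := by
  rw [Hz, if_neg (by omega)]; rfl

theorem Hz_neg (g : SymFn) {k : ℤ} (h : k < 0) : Hz g k = 0 := by simp [Hz, h]

theorem Hz_rec (g : SymFn) (n : ℕ) : (n : ℚ) • Hz g n =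
    ∑ i ∈ Finset.range n, adams (i+1) g * Hz g ((n : ℤ) - 1 - i) := by
  cases n with
  | zero => simp
  | succ k =>
    rw [Hz_nat, hPleth_rec]
    refine Finset.sum_congr rfl fun i hi => ?_
    have := Finset.mem_range.1 hi
    rw [show ((k + 1 : ℕ) : ℤ) - 1 - i = ((k - i : ℕ) : ℤ) by omega, Hz_nat]

/-- The auxiliary series `A`. -/
noncomputable def AA (k : ℤ) : Polynomial SymFn :=
  DD (Hz (hh 2) k) - Polynomial.X ^ 2 * DD (Hz (hh 2) (k - 1))

theorem shift_rec {R : Type*} [CommRing R] [Algebra ℚ R] (B A : ℤ → R) (a : ℕ → R) (x : R)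
    (hBneg : ∀ k : ℤ, k < 0 → B k = 0)
    (hrec : ∀ n : ℕ, (n : ℚ) • B n = ∑ i ∈ Finset.range n, a i * B ((n : ℤ) - 1 - i)
      + ∑ i ∈ Finset.range n, x ^ (i + 1) * B ((n : ℤ) - 1 - i))
    (hA : ∀ k, A k = B k - x * B (k - 1)) (k : ℕ) :
    ((k + 1 : ℕ) : ℚ) • A ((k + 1 : ℕ) : ℤ) =
      ∑ i ∈ Finset.range (k + 1), a i * A ((k - i : ℕ) : ℤ) := by
  have h1 : ((k + 1 : ℕ) : ℚ) • (x * B k) = x * ((k : ℚ) • B k) + x * B k := by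
    push_cast; rw [add_smul, one_smul, mul_smul_comm]
  have h2 : ∑ i ∈ Finset.range (k + 1), a i * A ((k - i : ℕ) : ℤ) =
      ∑ i ∈ Finset.range (k + 1), a i * B (((k + 1 : ℕ) : ℤ) - 1 - i) -
      x * ∑ i ∈ Finset.range k, a i * B ((k : ℤ) - 1 - i) := by
    have : ∑ i ∈ Finset.range k, a i * B ((k : ℤ) - 1 - i) =
        ∑ i ∈ Finset.range (k + 1), a i * B ((k : ℤ) - 1 - i) := by
      rw [Finset.sum_range_succ, hBneg ((k : ℤ) - 1 - k) (by omega), mul_zero, add_zero]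
    rw [this, Finset.mul_sum, ← Finset.sum_sub_distrib]
    refine Finset.sum_congr rfl fun i hi => ?_
    have := Finset.mem_range.1 hi
    rw [hA, show ((k + 1 : ℕ) : ℤ) - 1 - i = ((k - i : ℕ) : ℤ) by omega,
      show (k : ℤ) - 1 - i = ((k - i : ℕ) : ℤ) - 1 by omega]
    ring
  have h3 : ∑ i ∈ Finset.range (k + 1), x ^ (i + 1) * B (((k + 1 : ℕ) : ℤ) - 1 - i)
      = x * B k + x * ∑ i ∈ Finset.range k, x ^ (i + 1) * B ((k : ℤ) - 1 - i) := by
    rw [Finset.sum_range_succ', Finset.mul_sum, add_comm]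
    congr 1
    · simp
    · refine Finset.sum_congr rfl fun i _ => ?_
      rw [show ((k + 1 : ℕ) : ℤ) - 1 - ((i + 1 : ℕ) : ℤ) = (k : ℤ) - 1 - i by push_cast; ring]
      ring
  rw [h2, hA, smul_sub, hrec, show ((k + 1 : ℕ) : ℤ) - 1 = (k : ℤ) by omega, h1, hrec k]
  rw [show ((k + 1 : ℕ) : ℤ) - 1 = (k : ℤ) by omega] at h3
  rw [h3]
  ring

theorem AA_rec (k : ℕ) : ((k + 1 : ℕ) : ℚ) • AA ((k + 1 : ℕ) : ℤ) =
    ∑ i ∈ Finset.range (k + 1), (Polynomial.C (adams (i + 1) (hh 2)) +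
      Polynomial.C (pp (i + 1)) * Polynomial.X ^ (i + 1)) * AA ((k - i : ℕ) : ℤ) := by
  refine shift_rec (fun k => DD (Hz (hh 2) k)) AA
    (fun i => Polynomial.C (adams (i + 1) (hh 2)) +
      Polynomial.C (pp (i + 1)) * Polynomial.X ^ (i + 1)) (Polynomial.X ^ 2) ?_ ?_ ?_ k
  · intro k hk
    change DD (Hz (hh 2) k) = 0
    rw [Hz_neg _ hk, map_zero]
  · intro n
    rw [← map_smul, Hz_rec, map_sum, ← Finset.sum_add_distrib]
    refine Finset.sum_congr rfl fun i _ => ?_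
    rw [map_mul, DD_adams_h2 _ (by omega), add_mul, pow_mul]
  · intro k; rfl

theorem AA_bound (k : ℤ) : degLE (AA k) k := by
  by_cases hk : k < 0
  · rw [AA, Hz_neg _ hk, Hz_neg _ (by omega)]; simpa using degLE_zero _
  · obtain ⟨n, rfl⟩ : ∃ n : ℕ, k = n := ⟨k.toNat, by omega⟩
    refine degLE_of_rec (fun n => AA n) _ (fun i => a_bound _ _ i) ?_ AA_rec n
    change degLE (AA ((0 : ℕ) : ℤ)) 0
    rw [AA, Hz_neg (k := ((0 : ℕ) : ℤ) - 1) _ (by simp), Hz_nat, hPleth]; simpa using degLE_one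

theorem B_bound (k : ℤ) : degLE (DD (Hz (hh 2) k)) (2 * k) := by
  by_cases hk : k < 0
  · rw [Hz_neg _ hk, map_zero]; exact degLE_zero _
  · obtain ⟨n, rfl⟩ : ∃ n : ℕ, k = n := ⟨k.toNat, by omega⟩
    induction n with
    | zero => rw [Hz_nat, hPleth]; simpa using degLE_one
    | succ n ih =>
      have : DD (Hz (hh 2) ((n + 1 : ℕ) : ℤ)) = AA ((n + 1 : ℕ) : ℤ) +
          Polynomial.X ^ 2 * DD (Hz (hh 2) n) := by
        rw [AA, show ((n + 1 : ℕ) : ℤ) - 1 = n by omega]; ring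
      rw [this]
      refine ((AA_bound _).mono (by omega)).add ?_
      exact ((degLE_X_pow 2).mul (ih (by omega))).mono (by push_cast; omega)

/-- Jacobi–Trudi determinants. -/
noncomputable def JT {R : Type*} [CommRing R] (n : ℕ) (l : ℕ → ℤ) (u : ℤ → R) : R :=
  Matrix.det (Matrix.of fun i j : Fin n => u (l i + (j : ℤ) - (i : ℤ)))

theorem JT_col {R : Type*} [CommRing R] (n : ℕ) (l : ℕ → ℤ) (u v : ℤ → R) (x : R)
    (h : ∀ k, u k = v k + x * u (k - 1)) :
    JT (n + 1) l u = Matrix.det (Matrix.of fun i j : Fin (n + 1) =>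
      if j = 0 then u (l i - (i : ℤ)) else v (l i + (j : ℤ) - (i : ℤ))) := by
  refine Matrix.det_eq_of_forall_col_eq_smul_add_pred (fun _ => x) ?_ ?_
  · intro i; simp
  · intro i j
    simp only [Matrix.of_apply, if_neg (Fin.succ_ne_zero j)]
    rw [h]
    congr 3
    simp; ring

theorem JT_map {R S : Type*} [CommRing R] [CommRing S] (f : R →+* S) (n : ℕ) (l : ℕ → ℤ)
    (u : ℤ → R) : f (JT n l u) = JT n l (fun k => f (u k)) := by
  rw [JT, RingHom.map_det]; rfl

/-- parts of a partition as a function -/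
def parts (m : Multiset ℕ) (i : ℕ) : ℤ := ((sortedParts m).getD i 0 : ℕ)

theorem schur_eq (m : Multiset ℕ) : schur m = JT (Multiset.card m) (parts m) hh := rfl

theorem coe_sortedParts (m : Multiset ℕ) : (sortedParts m : Multiset ℕ) = m := by
  rw [sortedParts, Multiset.coe_reverse, Multiset.sort_eq]

theorem length_sortedParts (m : Multiset ℕ) : (sortedParts m).length = Multiset.card m := by
  simp [sortedParts]

theorem parts_le (m : Multiset ℕ) (i : ℕ) : parts m i ≤ firstPart m := by
  unfold parts
  by_cases h : i < (sortedParts m).length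
  · rw [List.getD_eq_getElem _ _ h]
    have : (sortedParts m)[i] ∈ m := by
      have h' := Multiset.mem_coe.2 (List.getElem_mem h)
      rwa [coe_sortedParts m] at h' 
    exact_mod_cast Multiset.le_sup this
  · rw [List.getD_eq_default _ _ (by omega)]; simp

theorem parts_sum (m : Multiset ℕ) : ∑ i : Fin (Multiset.card m), parts m i = psize m := by
  unfold parts psize
  conv_rhs => rw [← coe_sortedParts m, Multiset.sum_coe, ← Fin.sum_univ_getElem]
  rw [← length_sortedParts]
  push_cast
  refine Finset.sum_congr rfl fun i _ => ?_
  rw [List.getD_eq_getElem _ _ i.2]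

theorem sup_mem (m : Multiset ℕ) (h : m ≠ 0) : m.sup ∈ m := by
  induction m using Multiset.induction_on with
  | empty => exact absurd rfl h
  | cons a s ih =>
    rw [Multiset.sup_cons]
    by_cases hs : s = 0
    · subst hs; simp
    · rcases le_total a s.sup with h1 | h1
      · rw [sup_eq_right.2 h1]; exact Multiset.mem_cons_of_mem (ih hs)
      · rw [sup_eq_left.2 h1]; simp

theorem sortedParts_cons (m : Multiset ℕ) (h : m ≠ 0) :
    sortedParts m = m.sup :: sortedParts (m.erase m.sup) := by
  have hs : ∀ m, (sortedParts m).Pairwise (· ≥ ·) := fun m => by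
    unfold sortedParts
    rw [List.pairwise_reverse]
    exact Multiset.pairwise_sort _ _
  refine List.Perm.eq_of_pairwise' (hs m) ?_ ?_
  · refine List.Pairwise.cons ?_ (hs _)
    intro b hb
    rw [← Multiset.mem_coe, coe_sortedParts] at hb
    exact Multiset.le_sup (Multiset.mem_of_mem_erase hb)
  · rw [← Multiset.coe_eq_coe, ← Multiset.cons_coe, coe_sortedParts, coe_sortedParts,
      Multiset.cons_erase (sup_mem m h)]

theorem pleth_schur (m : Multiset ℕ) (g : SymFn) :
    pleth (schur m) g = JT (Multiset.card m) (parts m) (Hz g) := by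
  rw [schur_eq]
  have := JT_map (aeval (R := ℚ) (fun m => hPleth g (m+1)) : SymFn →ₐ[ℚ] SymFn).toRingHom
    (Multiset.card m) (parts m) hh
  refine Eq.trans this ?_
  congr 1
  funext k
  change aeval (fun m => hPleth g (m+1)) (hh k) = Hz g k
  rcases lt_trichotomy k 0 with h | h | h
  · rw [hh_neg h, map_zero, Hz_neg _ h]
  · subst h
    rw [hh_zero, map_one]; simp [Hz, hPleth]
  · obtain ⟨n, rfl⟩ : ∃ n : ℕ, k = n + 1 := ⟨(k - 1).toNat, by omega⟩
    rw [hh_succ, aeval_X]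
    exact (Hz_nat g (n + 1)).symm

theorem sum_aux (m : Multiset ℕ) :
    ∑ i : Fin (Multiset.card m), (parts m i - (i : ℤ)) + ∑ j : Fin (Multiset.card m), (j : ℤ)
      = psize m := by
  rw [Finset.sum_sub_distrib, parts_sum]; ring

theorem bound_mu (m : Multiset ℕ) : degLE (DD (pleth (schur m) (ee 2))) (psize m) := by
  rw [pleth_schur]
  have := JT_map DD.toRingHom (Multiset.card m) (parts m) (Hz (ee 2))
  change DD _ = _ at this
  rw [this, JT, ← sum_aux]
  refine degLE_det _ _ _ fun i j => ?_
  simp only [Matrix.of_apply]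
  change degLE (DD (Hz (ee 2) _)) _
  by_cases h : parts m i + (j : ℤ) - (i : ℤ) < 0
  · rw [Hz_neg _ h, map_zero]; exact degLE_zero _
  · obtain ⟨n, hn⟩ : ∃ n : ℕ, parts m i + (j : ℤ) - (i : ℤ) = n :=
      ⟨(parts m i + (j : ℤ) - (i : ℤ)).toNat, by omega⟩
    rw [hn, Hz_nat]
    exact (E_bound n).mono (by omega)

theorem bound_lam (m : Multiset ℕ) :
    degLE (DD (pleth (schur m) (hh 2))) (psize m + firstPart m) := by
  rw [pleth_schur]
  have := JT_map DD.toRingHom (Multiset.card m) (parts m) (Hz (hh 2))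
  change DD _ = _ at this
  rw [this, ← sum_aux]
  have hp := parts_le m
  generalize parts m = l at *
  generalize Multiset.card m = n at *
  generalize firstPart m = f at *
  cases n with
  | zero => 
    simp only [JT, Matrix.det_fin_zero]
    exact degLE_one.mono (by simp)
  | succ n =>
    rw [JT_col n l _ AA (Polynomial.X ^ 2) (fun k => by
      change DD _ = AA k + _ * DD _
      rw [AA]; ring)]
    have hs : (∑ j : Fin (n + 1), (j : ℤ)) + f =
        ∑ j : Fin (n + 1), ((j : ℤ) + if j = 0 then (f : ℤ) else 0) := by
      rw [Finset.sum_add_distrib, Finset.sum_ite_eq' Finset.univ]; simp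
    rw [add_assoc, hs]
    refine degLE_det _ _ _ fun i j => ?_
    simp only [Matrix.of_apply]
    have := hp i
    split_ifs with hj
    · subst hj
      exact (B_bound _).mono (by simp; omega)
    · exact (AA_bound _).mono (by omega)

theorem schur_coeff_succ (n : ℕ) (l : ℕ → ℤ) (m : ℕ) (hl : ∀ i, l i ≤ m) :
    (DD (JT (n + 1) l hh)).coeff m =
      if l 0 = m then JT n (fun i => l (i + 1)) hh else 0 := by
  have := JT_map DD.toRingHom (n + 1) l hh
  change DD _ = JT (n + 1) l (fun k => DD (hh k)) at this
  rw [this, JT_col n l _ (fun k => Polynomial.C (hh k)) Polynomial.X (fun k => DD_rec k),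
    Matrix.det_succ_column_zero, Polynomial.finsetSum_coeff, Fin.sum_univ_succ]
  have hsub : ∀ i : Fin (n + 1), ∃ a : SymFn, (Matrix.det ((Matrix.of fun i j : Fin (n + 1) =>
      if j = 0 then DD (hh (l i - (i : ℤ))) else
        Polynomial.C (hh (l i + (j : ℤ) - (i : ℤ)))).submatrix i.succAbove Fin.succ)) =
      Polynomial.C a := by
    intro i
    refine ⟨Matrix.det (Matrix.of fun i' j' : Fin n =>
      hh (l (i.succAbove i') + (j'.succ : ℕ) - ((i.succAbove i' : Fin (n+1)) : ℕ))), ?_⟩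
    rw [RingHom.map_det]
    congr 1
  have h0 : (Matrix.det ((Matrix.of fun i j : Fin (n + 1) =>
      if j = 0 then DD (hh (l i - (i : ℤ))) else
        Polynomial.C (hh (l i + (j : ℤ) - (i : ℤ)))).submatrix (Fin.succAbove 0) Fin.succ)) =
      Polynomial.C (JT n (fun i => l (i + 1)) hh) := by
    rw [JT, RingHom.map_det]
    congr 1
    ext1 i' j'
    simp [Fin.succ_ne_zero]
    congr 1; ring
  have hc : ∀ (i : ℕ) (p : Polynomial SymFn) (a : SymFn),
      ((-1) ^ i * p * Polynomial.C a).coeff m = (-1) ^ i * p.coeff m * a := by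
    intro i p a
    rw [Polynomial.coeff_mul_C, show ((-1) ^ i : Polynomial SymFn) = Polynomial.C ((-1) ^ i) by simp,
      Polynomial.coeff_C_mul]
  rw [h0, hc, Finset.sum_eq_zero, add_zero]
  · simp only [Matrix.of_apply, if_true, DD_coeff, Fin.val_zero, pow_zero, one_mul]
    have := hl 0
    split_ifs with h
    · rw [h]; simp [hh_zero]
    · rw [hh_neg (by simp; omega), zero_mul]
  · intro i _
    obtain ⟨a, ha⟩ := hsub i.succ
    rw [ha, hc]
    simp only [Matrix.of_apply, if_true, DD_coeff]
    have := hl i.succ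
    rw [hh_neg (by simp at this ⊢; omega)]; simp

theorem firstPart_zero_iff {k : Multiset ℕ} (hk : IsPartition k) (h : firstPart k = 0) : k = 0 := by
  by_contra hne
  have := sup_mem k hne
  unfold firstPart at h
  rw [h] at this
  exact hk this

theorem schur_coeff (k : Multiset ℕ) (m : ℕ) (hm : 0 < m) (hk : firstPart k ≤ m) :
    (DD (schur k)).coeff m = if firstPart k = m then schur (k.erase m) else 0 := by
  by_cases h : k = 0
  · subst h
    have h1 : schur 0 = 1 := by simp [schur]
    rw [h1, map_one, Polynomial.coeff_one, if_neg (by omega), if_neg]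
    simp [firstPart]; omega
  · have hs := sortedParts_cons k h
    have hcard : Multiset.card k = Multiset.card (k.erase k.sup) + 1 := by
      rw [Multiset.card_erase_add_one (sup_mem k h)]
    rw [schur_eq, hcard, schur_coeff_succ _ _ _ (fun i => (parts_le k i).trans (by exact_mod_cast hk))]
    have h0 : parts k 0 = firstPart k := by simp [parts, hs, firstPart]
    have h1 : (fun i => parts k (i + 1)) = parts (k.erase k.sup) := by
      funext i; simp [parts, hs]
    rw [h0, h1, ← schur_eq]
    simp only [Nat.cast_inj]
    split_ifs with h2
    · rw [← h2]; rfl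
    · rfl

theorem sum_coeff (S : Finset (Multiset ℕ)) (c : Multiset ℕ → ℚ) (m : ℕ) (hm : 0 < m)
    (hS : ∀ k ∈ S, firstPart k ≤ m) :
    (DD (∑ k ∈ S, c k • schur k)).coeff m =
      ∑ t ∈ (S.filter fun k => firstPart k = m).image (fun k => k.erase m),
        c (m ::ₘ t) • schur t := by
  have hcons : ∀ k, firstPart k = m → m ::ₘ (k.erase m) = k := by
    intro k h
    have hk : k ≠ 0 := by rintro rfl; simp [firstPart] at h; omega
    exact Multiset.cons_erase (h ▸ sup_mem k hk)
  rw [Finset.sum_image, Finset.sum_filter, map_sum, Polynomial.finsetSum_coeff]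
  · refine Finset.sum_congr rfl fun k hk => ?_
    rw [map_smul, Polynomial.coeff_smul, schur_coeff k m hm (hS k hk)]
    split_ifs with h
    · rw [hcons k h]
    · simp
  · intro a ha b hb hab
    simp only [Finset.coe_filter, Set.mem_setOf_eq] at ha hb
    rw [← hcons a ha.2, ← hcons b hb.2]
    exact congrArg _ hab

theorem schur_indep (N : ℕ) : ∀ (S : Finset (Multiset ℕ)) (c : Multiset ℕ → ℚ),
    (∀ k ∈ S, IsPartition k) → (∀ k ∈ S, Multiset.card k < N) →
    ∑ k ∈ S, c k • schur k = 0 → ∀ k ∈ S, c k = 0 := by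
  induction N with
  | zero => intro S c _ h2 _ k hk; exact absurd (h2 k hk) (by omega)
  | succ N ih =>
    intro S c h1 h2 h3
    by_contra! hcon
    classical
    set T := S.filter fun k => c k ≠ 0 with hT
    have hTne : T.Nonempty := by
      obtain ⟨k, hk, hk'⟩ := hcon
      exact ⟨k, by simp [hT, hk, hk']⟩
    have h3' : ∑ k ∈ T, c k • schur k = 0 := by
      rw [← h3, hT, Finset.sum_filter]
      refine Finset.sum_congr rfl fun k _ => ?_
      split_ifs with h
      · rfl
      · rw [not_not.1 h, zero_smul]
    obtain ⟨k0, hk0, hmax⟩ := Finset.exists_max_image T firstPart hTne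
    have hk0' := Finset.mem_filter.1 hk0
    by_cases hm : firstPart k0 = 0
    · have hz : ∀ k ∈ T, k = 0 := fun k hk =>
        firstPart_zero_iff (h1 k (Finset.mem_filter.1 hk).1) (by have := hmax k hk; omega)
      have hT1 : T = {0} := by
        refine Finset.eq_singleton_iff_unique_mem.2 ⟨hz k0 hk0 ▸ hk0, hz⟩
      rw [hT1, Finset.sum_singleton] at h3'
      have h1 : schur 0 = 1 := by simp [schur]
      rw [h1, smul_eq_zero] at h3'
      have : c k0 = 0 := by
        rw [hz k0 hk0]
        exact h3'.resolve_right one_ne_zero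
      exact hk0'.2 this
    · have hs := sum_coeff T c (firstPart k0) (by omega) hmax
      rw [h3', map_zero, Polynomial.coeff_zero] at hs
      have hmem : ∀ k ∈ T, firstPart k = firstPart k0 → firstPart k0 ∈ k := by
        intro k _ h
        have hk : k ≠ 0 := by rintro rfl; simp [firstPart] at h; simp [firstPart] at hm; omega
        exact h ▸ sup_mem k hk
      have hres := ih _ _ ?_ ?_ hs.symm (k0.erase (firstPart k0))
        (Finset.mem_image_of_mem _ (Finset.mem_filter.2 ⟨hk0, rfl⟩))
      · rw [Multiset.cons_erase (hmem k0 hk0 rfl)] at hres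
        exact hk0'.2 hres
      · intro t ht
        obtain ⟨k, hk, rfl⟩ := Finset.mem_image.1 ht
        have hk := (Finset.mem_filter.1 (Finset.mem_filter.1 hk).1).1
        exact fun h => h1 k hk (Multiset.mem_of_mem_erase h)
      · intro t ht
        obtain ⟨k, hk, rfl⟩ := Finset.mem_image.1 ht
        have hk := Finset.mem_filter.1 hk
        have h4 := h2 k (Finset.mem_filter.1 hk.1).1
        have h5 := Multiset.card_erase_add_one (hmem k hk.1 hk.2)
        omega

theorem firstPart_le_of_degLE (c : Multiset ℕ →₀ ℚ) (hc : ∀ k ∈ c.support, IsPartition k)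
    (d : ℕ) (hd : degLE (DD (c.sum fun k a => a • schur k)) d) :
    ∀ k ∈ c.support, firstPart k ≤ d := by
  intro k hk
  obtain ⟨k0, hk0, hmax⟩ := Finset.exists_max_image c.support firstPart ⟨k, hk⟩
  refine (hmax k hk).trans ?_
  by_contra hlt
  have hs := sum_coeff c.support c (firstPart k0) (by omega) hmax
  have h0 := hd (firstPart k0) (by omega)
  rw [Finsupp.sum, hs] at h0
  have hmem : firstPart k0 ∈ k0 := by
    have hk : k0 ≠ 0 := by rintro rfl; simp [firstPart] at hlt
    exact sup_mem k0 hk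
  have hres := schur_indep _ _ _ ?_ (fun k hk => Nat.lt_succ_of_le (Finset.le_sup (f := Multiset.card) hk))
    h0 (k0.erase (firstPart k0))
      (Finset.mem_image_of_mem _ (Finset.mem_filter.2 ⟨hk0, rfl⟩))
  · rw [Multiset.cons_erase hmem] at hres
    exact Finsupp.mem_support_iff.1 hk0 hres
  · intro t ht
    obtain ⟨k, hk, rfl⟩ := Finset.mem_image.1 ht
    exact fun h => hc k (Finset.mem_filter.1 hk).1 (Multiset.mem_of_mem_erase h)

/-- Let `λ, μ` be partitions with `|λ| + |μ| = n` and `ν` a partition with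
`2n ≥ |ν| + ν₁`. If the coefficient of `s_{ν[2n]}` in `(s_λ ∘ h₂)(s_μ ∘ e₂)` is nonzero,
then `|λ| - λ₁ ≤ |ν|` and `|μ| ≤ |ν|`. -/
theorem restriction_multiplicity_support_bounds
    (lam mu nu : Multiset ℕ)
    (hlam : IsPartition lam) (hmu : IsPartition mu) (hnu : IsPartition nu)
    (n : ℕ) (hn : psize lam + psize mu = n)
    (hnu2 : psize nu + firstPart nu ≤ 2 * n)
    (c : Multiset ℕ →₀ ℚ)
    (hc : SchurExpansion (pleth (schur lam) (hh 2) * pleth (schur mu) (ee 2)) c)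
    (hne : c (padded nu (2 * n)) ≠ 0) :
    psize lam - firstPart lam ≤ psize nu ∧ psize mu ≤ psize nu := by 
  obtain ⟨hpart, hf⟩ := hc
  have hd : degLE (DD (c.sum fun k a => a • schur k))
      ((psize lam + firstPart lam + psize mu : ℕ) : ℤ) := by
    rw [← hf, map_mul]
    exact ((bound_lam lam).mul (bound_mu mu)).mono (by push_cast; omega)
  have h1 := firstPart_le_of_degLE c hpart _ hd _ (Finsupp.mem_support_iff.2 hne)
  have h2 : 2 * n - psize nu ≤ firstPart (padded nu (2 * n)) :=
    Multiset.le_sup (Multiset.mem_cons_self _ _)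
  have h3 : firstPart lam ≤ psize lam :=
    Multiset.sup_le.2 fun b hb => Multiset.le_sum_of_mem hb
  constructor <;> omega
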